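/- For each integer m ≥ 1 let Σ_m := {(x_n)_{n∈ℤ} ∈ (ℤ/3ℤ)^ℤ : x_n ≠ x_{n+m!} for all n ∈ ℤ}, with the left shift σ. Then (Σ_m, σ) has no fixed point, and for every prime number p with p > m!, the set of p-periodic points P_p(Σ_m, σ) = {x ∈ Σ_m : σ^p x = x} is nonempty and finite. -/

import Mathlib

/-- The left shift on bi-infinite sequences. -/
def shift {α : Type*} (x : ℤ → α) : ℤ → α := fun n => x (n + 1)

/-- `Σ_m := {(x_n) ∈ (ℤ/3ℤ)^ℤ : x_n ≠ x_{n+m!} for all n}`. -/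
def SigmaSet (m : ℕ) : Set (ℤ → ZMod 3) :=
  {x | ∀ n : ℤ, x n ≠ x (n + (m.factorial : ℤ))}

theorem shift_iterate_apply {α : Type*} (k : ℕ) (x : ℤ → α) (n : ℤ) :
    shift^[k] x n = x (n + k) := by
  induction k generalizing x with
  | zero => simp
  | succ k ih =>
    rw [Function.iterate_succ_apply, ih, shift]
    push_cast
    ring_nf

theorem shift_iterate_eq_self_iff {α : Type*} (k : ℕ) (x : ℤ → α) :
    shift^[k] x = x ↔ Function.Periodic x (k : ℤ) := by
  simp only [funext_iff, shift_iterate_apply, Function.Periodic]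

theorem finite_periodicPts_shift {α : Type*} [Finite α] {k : ℕ} (hk : k ≠ 0) :
    {x : ℤ → α | shift^[k] x = x}.Finite := by
  refine Set.Finite.of_finite_image
    (f := fun (x : ℤ → α) (i : Fin k) => x i) (Set.toFinite _) ?_
  intro x hx y hy hxy
  rw [Set.mem_ofPred_eq, shift_iterate_eq_self_iff] at hx hy
  have hk' : (k : ℤ) ≠ 0 := by exact_mod_cast hk
  funext n
  have h0 := Int.emod_nonneg n hk'
  have hlt := Int.emod_lt_of_pos n (by omega : (0 : ℤ) < k)
  have hr := congrFun hxy ⟨(n % k).toNat, by omega⟩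
  simp only [Int.toNat_of_nonneg h0] at hr
  have aux : ∀ z : ℤ → α, Function.Periodic z (k : ℤ) → z (n % k) = z n := by
    intro z hz
    have h := hz.int_mul (n / k) (n % k)
    rw [← h]
    congr 1
    simpa [mul_comm] using Int.emod_add_mul_ediv n k
  rw [← aux x hx, ← aux y hy, hr]

/-- A proper `3`-colouring of the cycle of length `p`: alternate `0` and `1`, then close with `2`. -/
def cycleColoring (p : ℕ) (a : ZMod p) : ZMod 3 :=
  if a.val + 1 = p then 2 else if a.val % 2 = 0 then 0 else 1

theorem cycleColoring_ne_add_one {p : ℕ} (hp : 2 ≤ p) (a : ZMod p) :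
    cycleColoring p a ≠ cycleColoring p (a + 1) := by
  have : NeZero p := ⟨by omega⟩
  have : Fact (1 < p) := ⟨hp⟩
  have ha := a.val_lt
  have h01 : (0 : ZMod 3) ≠ 1 := by decide
  have h02 : (0 : ZMod 3) ≠ 2 := by decide
  have h12 : (1 : ZMod 3) ≠ 2 := by decide
  have hv : (a + 1).val = (a.val + 1) % p := by rw [ZMod.val_add, ZMod.val_one]
  unfold cycleColoring
  rw [hv]
  by_cases h : a.val + 1 = p
  · rw [if_pos h, h, Nat.mod_self, if_neg (by omega), if_pos rfl]
    exact h02.symm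
  · rw [if_neg h, Nat.mod_eq_of_lt (show a.val + 1 < p by omega)]
    split_ifs <;> first | omega | assumption | (apply Ne.symm; assumption)

/-- `(Σ_m, σ)` has no fixed point, and for every prime `p > m!` the set of
`p`-periodic points of `Σ_m` is nonempty and finite. -/
theorem stmt9 (m : ℕ) (hm : 1 ≤ m) :
    (∀ x ∈ SigmaSet m, shift x ≠ x) ∧
    ∀ p : ℕ, p.Prime → m.factorial < p →
      {x ∈ SigmaSet m | shift^[p] x = x}.Nonempty ∧
      {x ∈ SigmaSet m | shift^[p] x = x}.Finite := by
  refine ⟨fun x hx hfix => hx 0 ?_, fun p hp hlt => ⟨?_, ?_⟩⟩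
  · have h := congrFun (Function.iterate_fixed hfix m.factorial) 0
    rw [shift_iterate_apply] at h
    exact h.symm
  · have : Fact p.Prime := ⟨hp⟩
    have hu : (m.factorial : ZMod p) ≠ 0 := by
      rw [Ne, ZMod.natCast_eq_zero_iff]
      exact Nat.not_dvd_of_pos_of_lt m.factorial_pos hlt
    refine ⟨fun n => cycleColoring p ((n : ZMod p) * (m.factorial : ZMod p)⁻¹), ?_, ?_⟩
    · intro n
      push_cast
      rw [add_mul, mul_inv_cancel₀ hu]
      exact cycleColoring_ne_add_one hp.two_le _
    · rw [shift_iterate_eq_self_iff]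
      intro n
      simp
  · exact (finite_periodicPts_shift hp.ne_zero).subset fun x hx => hx.2
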